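/- arXiv:2209.12869 — 2 statements merged into one kernel-verified Lean document; each statement's English description precedes it below -/
import Mathlib

section
/- For any edit path P from a geometric graph G to a geometric graph H in ℝ^d, the induced inexact matching π_P := {(u,P(u)) : u ∈ V^G} ∪ {(P^{-1}(v),v) : v ∈ V^H} satisfies Cost(π_P) ≤ Cost(P). Consequently, GGD(G,H) ≤ GED(G,H) for all geometric graphs G, H in ℝ^d. -/
open scoped Classical
noncomputable section

/-- Points of the ambient Euclidean space `ℝ^d`. -/
abbrev Pt (d : ℕ) := EuclideanSpace ℝ (Fin d)

/-- A combinatorial graph embedded in `ℝ^d`: a finite vertex set of points together with a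
finite set of (oriented representatives of) straight-line edges, recorded as pairs of points. -/
structure EGraph (d : ℕ) where
  verts : Finset (Pt d)
  edges : Finset (Pt d × Pt d)

/-- A geometric graph of `ℝ^d`: the straight-line segments realizing the edges intersect
(possibly) only at shared endpoints. -/
structure GeoGraph (d : ℕ) extends EGraph d where
  edge_fst_mem : ∀ e ∈ edges, e.1 ∈ verts
  edge_snd_mem : ∀ e ∈ edges, e.2 ∈ verts
  edge_ne : ∀ e ∈ edges, e.1 ≠ e.2
  segments_meet_at_endpoints : ∀ e ∈ edges, ∀ f ∈ edges, e ≠ f →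
    ∀ p ∈ segment ℝ e.1 e.2 ∩ segment ℝ f.1 f.2,
      (p = e.1 ∨ p = e.2) ∧ (p = f.1 ∨ p = f.2)

/-- `Vol G`: the total edge length of `G`. -/
def EGraph.vol {d : ℕ} (G : EGraph d) : ℝ := ∑ e ∈ G.edges, dist e.1 e.2

/-- The degree of a vertex `u`: the number of edges incident to `u`. -/
def EGraph.degree {d : ℕ} (G : EGraph d) (u : Pt d) : ℕ :=
  (G.edges.filter (fun e => e.1 = u ∨ e.2 = u)).card

/-- The maximum vertex degree of a graph. -/
def EGraph.maxDegree {d : ℕ} (G : EGraph d) : ℕ := G.verts.sup G.degree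

/-- A graph has no isolated vertex when every vertex has an incident edge. -/
def NoIsolated {d : ℕ} (G : EGraph d) : Prop :=
  ∀ u ∈ G.verts, ∃ e ∈ G.edges, e.1 = u ∨ e.2 = u

/-- A state during an editing process: an abstract (labelled) combinatorial graph together
with an embedding of its vertices into `ℝ^d`.  Intermediate states need not be geometric
graphs (positions may even coincide). -/
structure EState (d : ℕ) where
  verts : Finset ℕ
  pos : ℕ → Pt d
  edges : Finset (ℕ × ℕ)

/-- A state represents a geometric graph when its embedded image is exactly that graph. -/
def EState.Represents {d : ℕ} (S : EState d) (G : EGraph d) : Prop :=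
  Set.InjOn S.pos ↑S.verts ∧
  S.verts.image S.pos = G.verts ∧
  (∀ e ∈ S.edges, e.1 ∈ S.verts ∧ e.2 ∈ S.verts) ∧
  S.edges.image (fun e => (S.pos e.1, S.pos e.2)) = G.edges

/-- The elementary edit operations. -/
inductive EditOp (d : ℕ) where
  | delVert (i : ℕ)
  | insVert (i : ℕ) (p : Pt d)
  | delEdge (i j : ℕ)
  | insEdge (i j : ℕ)
  | moveVert (i : ℕ) (p : Pt d)

namespace EditOp

/-- The effect of an edit operation on a state. -/
def apply {d : ℕ} (S : EState d) : EditOp d → EState d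
  | delVert i => ⟨S.verts.erase i, S.pos, S.edges⟩
  | insVert i p => ⟨insert i S.verts, Function.update S.pos i p, S.edges⟩
  | delEdge i j => ⟨S.verts, S.pos, S.edges.erase (i, j)⟩
  | insEdge i j => ⟨S.verts, S.pos, insert (i, j) S.edges⟩
  | moveVert i p => ⟨S.verts, Function.update S.pos i p, S.edges⟩

/-- Legality of an edit operation on a state: only isolated existing vertices may be deleted,
inserted vertices are new, deleted edges exist, and inserted edges join existing vertices. -/
def legal {d : ℕ} (S : EState d) : EditOp d → Prop
  | delVert i => i ∈ S.verts ∧ ∀ e ∈ S.edges, e.1 ≠ i ∧ e.2 ≠ i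
  | insVert i _ => i ∉ S.verts
  | delEdge i j => (i, j) ∈ S.edges
  | insEdge i j => i ∈ S.verts ∧ j ∈ S.verts ∧ (i, j) ∉ S.edges
  | moveVert i _ => i ∈ S.verts

/-- The cost of an edit operation: vertex insertion/deletion is free, edge insertion/deletion
costs `C_E` times the edge length, and translating a vertex costs `C_V` times the displacement
plus `C_E` times the total change in length of all incident edges. -/
def cost {d : ℕ} (CV CE : ℝ) (S : EState d) : EditOp d → ℝ
  | delVert _ => 0
  | insVert _ _ => 0
  | delEdge i j => CE * dist (S.pos i) (S.pos j)
  | insEdge i j => CE * dist (S.pos i) (S.pos j)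
  | moveVert i p => CV * dist (S.pos i) p +
      ∑ e ∈ S.edges,
        CE * |dist (Function.update S.pos i p e.1) (Function.update S.pos i p e.2)
                - dist (S.pos e.1) (S.pos e.2)|

/-- The inverse of an edit operation (relative to the state it is applied to). -/
def inv {d : ℕ} (S : EState d) : EditOp d → EditOp d
  | delVert i => insVert i (S.pos i)
  | insVert i _ => delVert i
  | delEdge i j => insEdge i j
  | insEdge i j => delEdge i j
  | moveVert i _ => moveVert i (S.pos i)

end EditOp

/-- Applying a sequence of edit operations. -/
def applyPath {d : ℕ} (S : EState d) (P : List (EditOp d)) : EState d :=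
  P.foldl EditOp.apply S

/-- Every operation of the sequence is legal on the intermediate result it is applied to. -/
def legalPath {d : ℕ} : EState d → List (EditOp d) → Prop
  | _, [] => True
  | S, o :: P => EditOp.legal S o ∧ legalPath (EditOp.apply S o) P

/-- The cost of an edit path: the sum of the costs of its individual edits. -/
def pathCost {d : ℕ} (CV CE : ℝ) : EState d → List (EditOp d) → ℝ
  | _, [] => 0
  | S, o :: P => EditOp.cost CV CE S o + pathCost CV CE (EditOp.apply S o) P

/-- The inverse edit path: the reversed sequence of the inverse operations. -/
def invPath {d : ℕ} : EState d → List (EditOp d) → List (EditOp d)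
  | _, [] => []
  | S, o :: P => invPath (EditOp.apply S o) P ++ [EditOp.inv S o]

/-- `P` is an edit path from `G` to `H`, starting at the representing state `S`. -/
def IsEditPathFrom {d : ℕ} (G H : EGraph d) (S : EState d) (P : List (EditOp d)) : Prop :=
  S.Represents G ∧ legalPath S P ∧ (applyPath S P).Represents H

/-- The geometric edit distance: the infimum cost of an edit path from `G` to `H`. -/
def GED {d : ℕ} (CV CE : ℝ) (G H : GeoGraph d) : ℝ :=
  sInf {c : ℝ | ∃ (S : EState d) (P : List (EditOp d)),
    IsEditPathFrom G.toEGraph H.toEGraph S P ∧ pathCost CV CE S P = c}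

/-- Distance between possibly-dummy vertices: `|a − ε_V| = 0`. -/
def odist {d : ℕ} : Option (Pt d) → Option (Pt d) → ℝ
  | some a, some b => dist a b
  | _, _ => 0

/-- Length of a possibly-dummy edge: `|ε_E| = 0`. -/
def elen {d : ℕ} : Option (Pt d × Pt d) → ℝ
  | some e => dist e.1 e.2
  | none => 0

/-- One step of the evolution of the vertex with label `i` under an edit operation;
a deleted vertex is recorded as the dummy vertex `none` and stays dummy. -/
def vStep {d : ℕ} (i : ℕ) (o : EditOp d) (s : Option (Pt d)) : Option (Pt d) :=
  match s, o with
  | none, _ => none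
  | some _, .delVert j => if j = i then none else s
  | some _, .moveVert j p => if j = i then some p else s
  | some _, _ => s

/-- The end result `P(u)` of the evolution of the vertex with label `i` under the path `P`. -/
def vTrack {d : ℕ} (i : ℕ) (P : List (EditOp d)) (s : Option (Pt d)) : Option (Pt d) :=
  P.foldl (fun s o => vStep i o s) s

/-- The cost of the orbit of the vertex with label `i`:
`C_V` times the total displacement along the orbit. -/
def vOrbitCost {d : ℕ} (CV : ℝ) (i : ℕ) : Option (Pt d) → List (EditOp d) → ℝ
  | _, [] => 0
  | s, o :: P => CV * odist s (vStep i o s) + vOrbitCost CV i (vStep i o s) P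

/-- One step of the evolution of the edge with label pair `(i, j)` under an edit operation;
a deleted edge (or an edge losing an endpoint) is recorded as the dummy edge `none`. -/
def eStep {d : ℕ} (i j : ℕ) (o : EditOp d) (s : Option (Pt d × Pt d)) :
    Option (Pt d × Pt d) :=
  match s, o with
  | none, _ => none
  | some _, .delEdge a b => if a = i ∧ b = j then none else s
  | some _, .delVert a => if a = i ∨ a = j then none else s
  | some q, .moveVert a p =>
      if a = i then some (p, q.2) else if a = j then some (q.1, p) else s
  | some _, _ => s

/-- The end result `P(e)` of the evolution of the edge with label pair `(i, j)` under `P`. -/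
def eTrack {d : ℕ} (i j : ℕ) (P : List (EditOp d)) (s : Option (Pt d × Pt d)) :
    Option (Pt d × Pt d) :=
  P.foldl (fun s o => eStep i j o s) s

/-- The cost of the orbit of the edge with label pair `(i, j)`:
`C_E` times the total variation of its length along the orbit. -/
def eOrbitCost {d : ℕ} (CE : ℝ) (i j : ℕ) : Option (Pt d × Pt d) → List (EditOp d) → ℝ
  | _, [] => 0
  | s, o :: P => CE * |elen (eStep i j o s) - elen s| + eOrbitCost CE i j (eStep i j o s) P

/-- An inexact matching between `G` and `H`: every vertex of `G` is matched with exactly one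
vertex of `H` or with the dummy vertex (`none`), and conversely, consistently. -/
structure Matching (d : ℕ) (G H : EGraph d) where
  f : Pt d → Option (Pt d)
  g : Pt d → Option (Pt d)
  f_mem : ∀ u ∈ G.verts, ∀ v, f u = some v → v ∈ H.verts
  g_mem : ∀ v ∈ H.verts, ∀ u, g v = some u → u ∈ G.verts
  consistent : ∀ u ∈ G.verts, ∀ v ∈ H.verts, (f u = some v ↔ g v = some u)

/-- The image `π(e) = (π(u₁), π(u₂))` of an edge under a matching: it is the dummy edge `none`
if either endpoint is matched with the dummy vertex, or if the image is not an edge of the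
target graph `T`. -/
def mEdge {d : ℕ} (T : EGraph d) (φ : Pt d → Option (Pt d)) (e : Pt d × Pt d) :
    Option (Pt d × Pt d) :=
  match φ e.1, φ e.2 with
  | some a, some b => if (a, b) ∈ T.edges then some (a, b) else none
  | _, _ => none

/-- The cost of an inexact matching: vertex translations, edge translations, and deletions of
the unmatched edges from both graphs. -/
def matchCost {d : ℕ} (CV CE : ℝ) {G H : EGraph d} (m : Matching d G H) : ℝ :=
  (∑ u ∈ G.verts.filter (fun u => m.f u ≠ none), CV * odist (some u) (m.f u)) +
  (∑ e ∈ G.edges.filter (fun e => mEdge H m.f e ≠ none),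
      CE * |dist e.1 e.2 - elen (mEdge H m.f e)|) +
  (∑ e ∈ G.edges.filter (fun e => mEdge H m.f e = none), CE * dist e.1 e.2) +
  (∑ f ∈ H.edges.filter (fun f => mEdge G m.g f = none), CE * dist f.1 f.2)

/-- The geometric graph distance: the minimum cost of an inexact matching. -/
def GGD {d : ℕ} (CV CE : ℝ) (G H : GeoGraph d) : ℝ :=
  sInf {c : ℝ | ∃ m : Matching d G.toEGraph H.toEGraph, matchCost CV CE m = c}

/-- The point `(a, b)` of `ℝ²`. -/
def pt2 (a b : ℝ) : Pt 2 := (WithLp.equiv 2 (Fin 2 → ℝ)).symm ![a, b]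

/-- The point `a` of `ℝ¹`. -/
def pt1 (a : ℝ) : Pt 1 := (WithLp.equiv 2 (Fin 1 → ℝ)).symm ![a]

/-- Every edge of the state joins existing vertices. -/
def EState.Valid {d : ℕ} (S : EState d) : Prop :=
  ∀ e ∈ S.edges, e.1 ∈ S.verts ∧ e.2 ∈ S.verts

/-- The label `i` is never deleted along `P`. -/
def Alive {d : ℕ} (i : ℕ) (P : List (EditOp d)) : Prop := EditOp.delVert i ∉ P

/-- Length of the label pair `e` in the state `S` (zero if it is not an edge). -/
def EState.len {d : ℕ} (S : EState d) (e : ℕ × ℕ) : ℝ :=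
  if e ∈ S.edges then dist (S.pos e.1) (S.pos e.2) else 0

/-- Edge contribution to the cost. -/
def edgeT {d : ℕ} (S : EState d) (P : List (EditOp d)) (e : ℕ × ℕ) : ℝ :=
  if Alive e.1 P ∧ Alive e.2 P then |S.len e - (applyPath S P).len e|
  else S.len e + (applyPath S P).len e

/-- Vertex contribution to the cost. -/
def vertW {d : ℕ} (S : EState d) (P : List (EditOp d)) (i : ℕ) : ℝ :=
  if i ∈ S.verts ∧ Alive i P then dist (S.pos i) ((applyPath S P).pos i) else 0

lemma EState.len_mem {d : ℕ} {S : EState d} {e : ℕ × ℕ} (h : e ∈ S.edges) :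
    S.len e = dist (S.pos e.1) (S.pos e.2) := if_pos h

lemma EState.len_not_mem {d : ℕ} {S : EState d} {e : ℕ × ℕ} (h : e ∉ S.edges) :
    S.len e = 0 := if_neg h

lemma EState.len_nonneg {d : ℕ} (S : EState d) (e : ℕ × ℕ) : 0 ≤ S.len e := by
  unfold EState.len; split_ifs <;> positivity

lemma vertW_nonneg {d : ℕ} (S : EState d) (P : List (EditOp d)) (i : ℕ) : 0 ≤ vertW S P i := by
  unfold vertW; split_ifs <;> positivity

lemma edgeT_nonneg {d : ℕ} (S : EState d) (P : List (EditOp d)) (e : ℕ × ℕ) :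
    0 ≤ edgeT S P e := by
  have h1 := S.len_nonneg e
  have h2 := (applyPath S P).len_nonneg e
  unfold edgeT; split_ifs <;> positivity

lemma valid_apply {d : ℕ} {S : EState d} (hS : S.Valid) (o : EditOp d) (ho : EditOp.legal S o) :
    (EditOp.apply S o).Valid := by
  intro e he
  cases o with
  | delVert i =>
    simp only [EditOp.apply, EditOp.legal] at *
    have := ho.2 e he
    have := hS e he
    simp_all
  | insVert i p =>
    simp only [EditOp.apply, EditOp.legal] at *
    have := hS e he
    simp_all
  | delEdge i j =>
    simp only [EditOp.apply, EditOp.legal] at *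
    exact hS e (Finset.mem_of_mem_erase he)
  | insEdge i j =>
    simp only [EditOp.apply, EditOp.legal] at *
    rcases Finset.mem_insert.1 he with rfl | h
    · exact ⟨ho.1, ho.2.1⟩
    · exact hS e h
  | moveVert i p =>
    exact hS e he

lemma applyPath_cons {d : ℕ} (S : EState d) (o : EditOp d) (P : List (EditOp d)) :
    applyPath S (o :: P) = applyPath (EditOp.apply S o) P := rfl

lemma alive_cons {d : ℕ} (i : ℕ) (o : EditOp d) (P : List (EditOp d)) :
    Alive i (o :: P) ↔ o ≠ .delVert i ∧ Alive i P := by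
  unfold Alive
  rw [List.mem_cons, not_or]
  constructor
  · rintro ⟨h, h'⟩; exact ⟨fun x => h x.symm, h'⟩
  · rintro ⟨h, h'⟩; exact ⟨fun x => h x.symm, h'⟩

lemma mem_apply_of_ne {d : ℕ} {S : EState d} {i : ℕ} (hi : i ∈ S.verts) (o : EditOp d)
    (ho : o ≠ .delVert i) : i ∈ (EditOp.apply S o).verts := by
  cases o <;> simp_all [EditOp.apply]
  rintro rfl; exact ho rfl

lemma edgeT_cons {d : ℕ} {S : EState d} (o : EditOp d) (P : List (EditOp d))
    (ho : EditOp.legal S o) (e : ℕ × ℕ) :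
    edgeT S (o :: P) e ≤ |(EditOp.apply S o).len e - S.len e| + edgeT (EditOp.apply S o) P e := by
  have h1 := S.len_nonneg e
  have h2 := (EditOp.apply S o).len_nonneg e
  have h3 := (applyPath (EditOp.apply S o) P).len_nonneg e
  unfold edgeT
  rw [applyPath_cons]
  generalize hL : (applyPath (EditOp.apply S o) P).len e = L at *
  have key : (o = .delVert e.1 ∨ o = .delVert e.2) →
      S.len e = 0 ∧ (EditOp.apply S o).len e = 0 := by
    intro h
    have hne : e ∉ S.edges := by
      rcases h with rfl | rfl
      · exact fun he => (ho.2 e he).1 rfl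
      · exact fun he => (ho.2 e he).2 rfl
    rcases h with rfl | rfl <;> simp [EState.len, EditOp.apply, hne]
  by_cases hk : o = .delVert e.1 ∨ o = .delVert e.2
  · obtain ⟨k1, k2⟩ := key hk
    have : ¬ (Alive e.1 (o :: P) ∧ Alive e.2 (o :: P)) := by
      rw [alive_cons, alive_cons]; tauto
    rw [if_neg this, k1, k2]
    split_ifs
    · simp [abs_of_nonneg h3]
    · simp
  · have : (Alive e.1 (o :: P) ∧ Alive e.2 (o :: P)) ↔ (Alive e.1 P ∧ Alive e.2 P) := by
      rw [alive_cons, alive_cons]; tauto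
    simp only [this]
    split_ifs
    · rw [abs_sub_comm ((EditOp.apply S o).len e)]
      exact abs_sub_le _ _ _
    · have := neg_abs_le ((EditOp.apply S o).len e - S.len e)
      linarith

/-- Displacement of a label under one operation. -/
def disp {d : ℕ} (S : EState d) (o : EditOp d) (i : ℕ) : ℝ :=
  if i ∈ S.verts then dist (S.pos i) ((EditOp.apply S o).pos i) else 0

lemma vertW_cons {d : ℕ} {S : EState d} (o : EditOp d) (P : List (EditOp d)) (i : ℕ) :
    vertW S (o :: P) i ≤ disp S o i + vertW (EditOp.apply S o) P i := by
  have h0 := vertW_nonneg (EditOp.apply S o) P i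
  have h1 : 0 ≤ disp S o i := by unfold disp; split_ifs <;> positivity
  by_cases h : i ∈ S.verts ∧ Alive i (o :: P)
  · have h' := (alive_cons _ _ _).1 h.2
    have hm := mem_apply_of_ne h.1 o h'.1
    unfold vertW disp
    rw [if_pos h, if_pos h.1, if_pos ⟨hm, h'.2⟩, applyPath_cons]
    exact dist_triangle _ _ _
  · rw [vertW, if_neg h]; linarith

lemma op_cost_ge {d : ℕ} {CV CE : ℝ} (hCV : 0 < CV) (hCE : 0 < CE) {S : EState d} (hS : S.Valid)
    (o : EditOp d) (ho : EditOp.legal S o) (V : Finset ℕ) (F : Finset (ℕ × ℕ)) :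
    CV * ∑ i ∈ V, disp S o i + CE * ∑ e ∈ F, |(EditOp.apply S o).len e - S.len e|
      ≤ EditOp.cost CV CE S o := by
  cases o with
  | delVert i =>
    have hl : ∀ e, (EditOp.apply S (.delVert i)).len e = S.len e := fun e => rfl
    simp only [hl]
    simp [disp, EditOp.apply, EditOp.cost]
  | insVert i p =>
    have hd : ∀ j, disp S (.insVert i p) j = 0 := by
      intro j
      unfold disp
      split_ifs with h
      · have : j ≠ i := by rintro rfl; exact ho h
        simp [EditOp.apply, this]
      · rfl
    have hl : ∀ e, (EditOp.apply S (.insVert i p)).len e = S.len e := by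
      intro e
      by_cases h : e ∈ S.edges
      · rw [EState.len_mem h, EState.len_mem (show e ∈ (EditOp.apply S (.insVert i p)).edges from h)]
        have h1 : e.1 ≠ i := fun h' => ho (h' ▸ (hS e h).1)
        have h2 : e.2 ≠ i := fun h' => ho (h' ▸ (hS e h).2)
        simp [EditOp.apply, h1, h2]
      · rw [EState.len_not_mem h]
        exact EState.len_not_mem h
    simp [hd, hl, EditOp.cost]
  | delEdge i j =>
    have hd : ∀ k, disp S (.delEdge i j) k = 0 := by
      intro k; simp [disp, EditOp.apply]
    have hl : ∀ e ∈ F, |(EditOp.apply S (.delEdge i j)).len e - S.len e| ≤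
        if e = (i, j) then dist (S.pos i) (S.pos j) else 0 := by
      intro e _
      unfold EState.len
      simp only [EditOp.apply]
      by_cases h : e = (i, j)
      · subst h
        have : (i, j) ∈ S.edges := ho
        simp [this]
      · simp [h]
    have := Finset.sum_le_sum hl
    rw [Finset.sum_ite_eq'] at this
    simp only [hd, EditOp.cost, Finset.sum_const_zero, mul_zero, zero_add]
    refine mul_le_mul_of_nonneg_left (this.trans ?_) hCE.le
    split_ifs <;> simp
  | insEdge i j =>
    have hd : ∀ k, disp S (.insEdge i j) k = 0 := by
      intro k; simp [disp, EditOp.apply]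
    have hl : ∀ e ∈ F, |(EditOp.apply S (.insEdge i j)).len e - S.len e| ≤
        if e = (i, j) then dist (S.pos i) (S.pos j) else 0 := by
      intro e _
      unfold EState.len
      simp only [EditOp.apply]
      by_cases h : e = (i, j)
      · subst h
        have : (i, j) ∉ S.edges := ho.2.2
        simp [this]
      · simp [h]
    have := Finset.sum_le_sum hl
    rw [Finset.sum_ite_eq'] at this
    simp only [hd, EditOp.cost, Finset.sum_const_zero, mul_zero, zero_add]
    refine mul_le_mul_of_nonneg_left (this.trans ?_) hCE.le
    split_ifs <;> simp
  | moveVert i p =>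
    have hd : ∀ k ∈ V, disp S (.moveVert i p) k ≤ if k = i then dist (S.pos i) p else 0 := by
      intro k _
      unfold disp
      simp only [EditOp.apply]
      by_cases h : k = i
      · subst h
        have : k ∈ S.verts := ho
        simp [this]
      · simp [h]
    have h1 := Finset.sum_le_sum hd
    rw [Finset.sum_ite_eq'] at h1
    have h1' : ∑ k ∈ V, disp S (.moveVert i p) k ≤ dist (S.pos i) p :=
      h1.trans (by split_ifs <;> simp)
    have h2 : ∑ e ∈ F, |(EditOp.apply S (.moveVert i p)).len e - S.len e| ≤
        ∑ e ∈ S.edges, |dist (Function.update S.pos i p e.1) (Function.update S.pos i p e.2)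
                - dist (S.pos e.1) (S.pos e.2)| := by
      have h3 : ∀ e ∈ F, |(EditOp.apply S (.moveVert i p)).len e - S.len e| =
          if e ∈ S.edges then
            |dist (Function.update S.pos i p e.1) (Function.update S.pos i p e.2)
                - dist (S.pos e.1) (S.pos e.2)| else 0 := by
        intro e _
        split_ifs with h
        · rw [EState.len_mem h,
            EState.len_mem (show e ∈ (EditOp.apply S (.moveVert i p)).edges from h)]
          rfl
        · rw [EState.len_not_mem h,
            EState.len_not_mem (show e ∉ (EditOp.apply S (.moveVert i p)).edges from h)]
          simp
      rw [Finset.sum_congr rfl h3, ← Finset.sum_filter]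
      refine Finset.sum_le_sum_of_subset_of_nonneg ?_ (fun _ _ _ => abs_nonneg _)
      intro e he
      exact (Finset.mem_filter.1 he).2
    simp only [EditOp.cost, ← Finset.mul_sum]
    gcongr

lemma path_cost_ge {d : ℕ} {CV CE : ℝ} (hCV : 0 < CV) (hCE : 0 < CE)
    (V : Finset ℕ) (F : Finset (ℕ × ℕ)) (P : List (EditOp d)) :
    ∀ S : EState d, S.Valid → legalPath S P →
    CV * ∑ i ∈ V, vertW S P i + CE * ∑ e ∈ F, edgeT S P e ≤ pathCost CV CE S P := by
  induction P with
  | nil =>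
    intro S _ _
    simp [vertW, edgeT, applyPath, pathCost, Alive]
  | cons o P ih =>
    intro S hS hP
    have h1 := ih _ (valid_apply hS o hP.1) hP.2
    have h2 := op_cost_ge hCV hCE hS o hP.1 V F
    have h3 := Finset.sum_le_sum (fun i (_ : i ∈ V) => vertW_cons (S := S) o P i)
    have h4 := Finset.sum_le_sum (fun e (_ : e ∈ F) => edgeT_cons (S := S) o P hP.1 e)
    rw [Finset.sum_add_distrib] at h3 h4
    have h3' := mul_le_mul_of_nonneg_left h3 hCV.le
    have h4' := mul_le_mul_of_nonneg_left h4 hCE.le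
    rw [mul_add] at h3' h4'
    simp only [pathCost]
    linarith

lemma vTrack_none {d : ℕ} (i : ℕ) (P : List (EditOp d)) : vTrack i P none = none := by
  induction P with
  | nil => rfl
  | cons o P ih => simpa [vTrack, vStep] using ih

lemma vTrack_cons {d : ℕ} (i : ℕ) (o : EditOp d) (P : List (EditOp d)) (s : Option (Pt d)) :
    vTrack i (o :: P) s = vTrack i P (vStep i o s) := rfl

lemma vTrack_eq {d : ℕ} (i : ℕ) (P : List (EditOp d)) :
    ∀ S : EState d, legalPath S P → i ∈ S.verts →
    vTrack i P (some (S.pos i)) =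
      if Alive i P then some ((applyPath S P).pos i) else none := by
  induction P with
  | nil => intro S _ _; simp [vTrack, applyPath, Alive]
  | cons o P ih =>
    intro S hP hi
    rw [vTrack_cons, applyPath_cons]
    by_cases ho : o = .delVert i
    · subst ho
      simp [vStep, vTrack_none, alive_cons]
    · have h := ih _ hP.2 (mem_apply_of_ne hi o ho)
      have hs : vStep i o (some (S.pos i)) = some ((EditOp.apply S o).pos i) := by
        have hl := hP.1
        cases o with
        | delVert j =>
          have : j ≠ i := by rintro rfl; exact ho rfl
          simp [vStep, EditOp.apply, this]
        | insVert j p =>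
          have : i ≠ j := by rintro rfl; exact hl hi
          simp [vStep, EditOp.apply, this]
        | delEdge j k => simp [vStep, EditOp.apply]
        | insEdge j k => simp [vStep, EditOp.apply]
        | moveVert j p =>
          by_cases h : j = i
          · subst h; simp [vStep, EditOp.apply]
          · simp [vStep, EditOp.apply, h, Ne.symm h]
      rw [hs, h]
      simp [alive_cons, ho]

lemma mem_final {d : ℕ} (i : ℕ) (P : List (EditOp d)) :
    ∀ S : EState d, i ∈ S.verts → Alive i P → i ∈ (applyPath S P).verts := by
  induction P with
  | nil => intro S h _; exact h
  | cons o P ih =>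
    intro S hi hA
    have h' := (alive_cons _ _ _).1 hA
    exact ih _ (mem_apply_of_ne hi o h'.1) h'.2

lemma vTrack_inv_eq {d : ℕ} (j : ℕ) (P : List (EditOp d)) :
    ∀ S : EState d, legalPath S P → j ∈ (applyPath S P).verts →
    vTrack j (invPath S P) (some ((applyPath S P).pos j)) =
      if j ∈ S.verts ∧ Alive j P then some (S.pos j) else none := by
  induction P with
  | nil =>
    intro S _ hj
    have hj' : j ∈ S.verts := hj
    simp [vTrack, applyPath, Alive, invPath, hj']
  | cons o P ih =>
    intro S hP hj
    have h := ih _ hP.2 hj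
    have e1 : vTrack j (invPath S (o :: P)) (some ((applyPath S (o :: P)).pos j)) =
        vStep j (EditOp.inv S o) (vTrack j (invPath (EditOp.apply S o) P)
          (some ((applyPath (EditOp.apply S o) P).pos j))) := by
      simp [vTrack, invPath, applyPath]
    rw [e1, h]
    have hl := hP.1
    simp only [alive_cons]
    cases o with
    | delVert i =>
      by_cases hij : i = j
      · subst hij
        simp [EditOp.apply, vStep]
      · by_cases hA : j ∈ S.verts ∧ Alive j P
        · simp [EditOp.apply, EditOp.inv, vStep, hij, Ne.symm hij, hA]
        · simp [EditOp.apply, EditOp.inv, vStep, hij, Ne.symm hij, hA]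
    | insVert i p =>
      by_cases hij : i = j
      · subst hij
        have : i ∉ S.verts := hl
        by_cases hA : Alive i P <;> simp [EditOp.apply, EditOp.inv, vStep, this, hA]
      · by_cases hA : j ∈ S.verts ∧ Alive j P
        · simp [EditOp.apply, EditOp.inv, vStep, hij, Ne.symm hij, hA]
        · simp [EditOp.apply, EditOp.inv, vStep, hij, Ne.symm hij, hA]
    | delEdge a b =>
      by_cases hA : j ∈ S.verts ∧ Alive j P <;> simp [EditOp.apply, EditOp.inv, vStep, hA]
    | insEdge a b =>
      by_cases hA : j ∈ S.verts ∧ Alive j P <;> simp [EditOp.apply, EditOp.inv, vStep, hA]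
    | moveVert i p =>
      by_cases hij : i = j
      · subst hij
        by_cases hA : i ∈ S.verts ∧ Alive i P <;> simp [EditOp.apply, EditOp.inv, vStep, hA]
      · by_cases hA : j ∈ S.verts ∧ Alive j P
        · simp [EditOp.apply, EditOp.inv, vStep, hij, Ne.symm hij, hA]
        · simp [EditOp.apply, EditOp.inv, vStep, hij, Ne.symm hij, hA]

lemma matchCost_nonneg {d : ℕ} {CV CE : ℝ} (hCV : 0 < CV) (hCE : 0 < CE) {G H : EGraph d}
    (m : Matching d G H) : 0 ≤ matchCost CV CE m := by
  have ho : ∀ a b : Option (Pt d), 0 ≤ odist a b := by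
    intro a b
    cases a <;> cases b <;> simp [odist]
  unfold matchCost
  have h1 : 0 ≤ ∑ u ∈ G.verts.filter (fun u => m.f u ≠ none), CV * odist (some u) (m.f u) :=
    Finset.sum_nonneg (fun u _ => mul_nonneg hCV.le (ho _ _))
  positivity

/-- Reachability by a legal sequence of edits. -/
def Reach {d : ℕ} (S T : EState d) : Prop := ∃ P, legalPath S P ∧ applyPath S P = T

lemma Reach.refl {d : ℕ} (S : EState d) : Reach S S := ⟨[], trivial, rfl⟩

lemma Reach.cons {d : ℕ} {S T : EState d} (o : EditOp d) (ho : EditOp.legal S o)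
    (h : Reach (EditOp.apply S o) T) : Reach S T := by
  obtain ⟨P, h1, h2⟩ := h
  exact ⟨o :: P, ⟨ho, h1⟩, h2⟩

lemma legalPath_append {d : ℕ} (P Q : List (EditOp d)) :
    ∀ S, legalPath S P → legalPath (applyPath S P) Q → legalPath S (P ++ Q) := by
  induction P with
  | nil => intro S _ h; exact h
  | cons o P ih => intro S h h'; exact ⟨h.1, ih _ h.2 h'⟩

lemma Reach.trans {d : ℕ} {S T U : EState d} (h : Reach S T) (h' : Reach T U) : Reach S U := by
  obtain ⟨P, h1, rfl⟩ := h
  obtain ⟨Q, h2, rfl⟩ := h'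
  exact ⟨P ++ Q, legalPath_append _ _ _ h1 h2, by simp [applyPath]⟩

lemma reach_delEdges {d : ℕ} (V : Finset ℕ) (pos : ℕ → Pt d) (E : Finset (ℕ × ℕ)) :
    Reach ⟨V, pos, E⟩ ⟨V, pos, ∅⟩ := by
  induction E using Finset.induction_on with
  | empty => exact Reach.refl _
  | insert e E he ih =>
    refine Reach.cons (.delEdge e.1 e.2) (by simp [EditOp.legal]) ?_
    simpa [EditOp.apply, he] using ih

lemma reach_delVerts {d : ℕ} (V : Finset ℕ) (pos : ℕ → Pt d) :
    Reach ⟨V, pos, ∅⟩ ⟨∅, pos, ∅⟩ := by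
  induction V using Finset.induction_on with
  | empty => exact Reach.refl _
  | insert i V hi ih =>
    refine Reach.cons (.delVert i) (by simp [EditOp.legal]) ?_
    simpa [EditOp.apply, hi] using ih

lemma reach_insVerts {d : ℕ} (V : Finset ℕ) (pos : ℕ → Pt d) :
    Reach ⟨∅, pos, ∅⟩ ⟨V, pos, ∅⟩ := by
  induction V using Finset.induction_on with
  | empty => exact Reach.refl _
  | insert i V hi ih =>
    refine ih.trans (Reach.cons (.insVert i (pos i)) (by simpa [EditOp.legal] using hi) ?_)
    simpa [EditOp.apply] using Reach.refl _

lemma reach_insEdges {d : ℕ} (V : Finset ℕ) (pos : ℕ → Pt d) (E : Finset (ℕ × ℕ)) :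
    (∀ e ∈ E, e.1 ∈ V ∧ e.2 ∈ V) → Reach ⟨V, pos, ∅⟩ ⟨V, pos, E⟩ := by
  induction E using Finset.induction_on with
  | empty => intro _; exact Reach.refl _
  | insert e E he ih =>
    intro h
    refine (ih (fun f hf => h f (Finset.mem_insert_of_mem hf))).trans
      (Reach.cons (.insEdge e.1 e.2) ?_ ?_)
    · exact ⟨(h e (Finset.mem_insert_self _ _)).1, (h e (Finset.mem_insert_self _ _)).2, he⟩
    · exact Reach.refl _

lemma exists_editPath {d : ℕ} (G H : GeoGraph d) :
    ∃ S P, IsEditPathFrom G.toEGraph H.toEGraph S P := by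
  obtain ⟨enc, henc⟩ : ∃ enc : Pt d → ℕ, Set.InjOn enc ↑(G.verts ∪ H.verts) := by
    have := (G.verts ∪ H.verts).finite_toSet.countable
    exact Set.countable_iff_exists_injOn.1 this
  have hinv : ∀ x ∈ G.verts ∪ H.verts,
      Function.invFunOn enc (↑(G.verts ∪ H.verts) : Set (Pt d)) (enc x) = x := fun x hx =>
    henc.leftInvOn_invFunOn hx
  generalize Function.invFunOn enc (↑(G.verts ∪ H.verts) : Set (Pt d)) = pos at hinv
  have hrep : ∀ K : GeoGraph d, K.verts ⊆ G.verts ∪ H.verts →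
      EState.Represents ⟨K.verts.image enc, pos, K.edges.image (Prod.map enc enc)⟩ K.toEGraph := by
    intro K hK
    refine ⟨?_, ?_, ?_, ?_⟩
    · intro a ha b hb hab
      simp only [Finset.coe_image, Set.mem_image] at ha hb
      obtain ⟨x, hx, rfl⟩ := ha
      obtain ⟨y, hy, rfl⟩ := hb
      simp only at hab
      rw [hinv x (hK hx), hinv y (hK hy)] at hab
      rw [hab]
    · simp only [Finset.image_image]
      ext x
      simp only [Finset.mem_image, Function.comp]
      constructor
      · rintro ⟨y, hy, rfl⟩; rwa [hinv y (hK hy)]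
      · intro hx; exact ⟨x, hx, hinv x (hK hx)⟩
    · intro e he
      obtain ⟨f, hf, rfl⟩ := Finset.mem_image.1 he
      exact ⟨Finset.mem_image_of_mem _ (K.edge_fst_mem f hf),
        Finset.mem_image_of_mem _ (K.edge_snd_mem f hf)⟩
    · simp only [Finset.image_image]
      have hk : ∀ f ∈ K.edges, (pos (enc f.1), pos (enc f.2)) = f := fun f hf => by
        rw [hinv _ (hK (K.edge_fst_mem f hf)), hinv _ (hK (K.edge_snd_mem f hf))]
      ext x
      simp only [Finset.mem_image, Function.comp, Prod.map_fst, Prod.map_snd]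
      constructor
      · rintro ⟨y, hy, rfl⟩; rwa [hk y hy]
      · intro hx; exact ⟨x, hx, hk x hx⟩
  have hG := hrep G Finset.subset_union_left
  have hH := hrep H Finset.subset_union_right
  obtain ⟨P, hP, hP'⟩ := (reach_delEdges (G.verts.image enc) pos
    (G.edges.image (Prod.map enc enc))).trans ((reach_delVerts _ _).trans
      ((reach_insVerts _ _).trans (reach_insEdges (H.verts.image enc) pos
        (H.edges.image (Prod.map enc enc)) hH.2.2.1)))
  exact ⟨_, P, hG, hP, hP' ▸ hH⟩

lemma exists_label_fun {d : ℕ} {α : Type*} (V : Finset ℕ) (pos : ℕ → Pt d)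
    (h : Set.InjOn pos ↑V) (F : ℕ → α) : ∃ f : Pt d → α, ∀ i ∈ V, f (pos i) = F i :=
  ⟨fun x => F (Function.invFunOn pos (↑V : Set ℕ) x), fun i hi => by
    have := h.leftInvOn_invFunOn (show i ∈ (↑V : Set ℕ) from hi)
    simp only [this]⟩

lemma Represents.mem_edges {d : ℕ} {S : EState d} {G : EGraph d} (h : S.Represents G) {i j : ℕ}
    (hi : i ∈ S.verts) (hj : j ∈ S.verts) :
    (S.pos i, S.pos j) ∈ G.edges ↔ (i, j) ∈ S.edges := by
  obtain ⟨h1, h2, h3, h4⟩ := h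
  rw [← h4, Finset.mem_image]
  constructor
  · rintro ⟨e, he, hee⟩
    simp only [Prod.mk.injEq] at hee
    have a := h1 (h3 e he).1 hi hee.1
    have b := h1 (h3 e he).2 hj hee.2
    have : e = (i, j) := Prod.ext a b
    exact this ▸ he
  · intro he; exact ⟨_, he, rfl⟩

lemma Represents.sum_edges {d : ℕ} {S : EState d} {G : EGraph d} (h : S.Represents G)
    (F : Pt d × Pt d → ℝ) :
    ∑ e ∈ G.edges, F e = ∑ e ∈ S.edges, F (S.pos e.1, S.pos e.2) := by
  obtain ⟨h1, h2, h3, h4⟩ := h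
  rw [← h4, Finset.sum_image]
  intro a ha b hb hab
  simp only [Prod.mk.injEq] at hab
  exact Prod.ext (h1 (h3 a ha).1 (h3 b hb).1 hab.1) (h1 (h3 a ha).2 (h3 b hb).2 hab.2)

lemma Represents.sum_verts {d : ℕ} {S : EState d} {G : EGraph d} (h : S.Represents G)
    (F : Pt d → ℝ) :
    ∑ u ∈ G.verts, F u = ∑ i ∈ S.verts, F (S.pos i) := by
  obtain ⟨h1, h2, h3, h4⟩ := h
  rw [← h2, Finset.sum_image]
  exact h1

lemma induced_matching {d : ℕ} {CV CE : ℝ} (hCV : 0 < CV) (hCE : 0 < CE)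
    (G H : GeoGraph d) (S : EState d) (P : List (EditOp d))
    (hP : IsEditPathFrom G.toEGraph H.toEGraph S P) :
      ∃ m : Matching d G.toEGraph H.toEGraph,
        (∀ i ∈ S.verts, m.f (S.pos i) = vTrack i P (some (S.pos i))) ∧
        (∀ j ∈ (applyPath S P).verts,
          m.g ((applyPath S P).pos j) =
            vTrack j (invPath S P) (some ((applyPath S P).pos j))) ∧
        matchCost CV CE m ≤ pathCost CV CE S P := by
  obtain ⟨hS, hleg, hT⟩ := hP
  obtain ⟨f, hf⟩ := exists_label_fun S.verts S.pos hS.1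
    (fun i => vTrack i P (some (S.pos i)))
  obtain ⟨g, hg⟩ := exists_label_fun (applyPath S P).verts (applyPath S P).pos hT.1
    (fun j => vTrack j (invPath S P) (some ((applyPath S P).pos j)))
  have hf' : ∀ i ∈ S.verts, f (S.pos i) =
      if Alive i P then some ((applyPath S P).pos i) else none := fun i hi => by
    rw [hf i hi, vTrack_eq i P S hleg hi]
  have hg' : ∀ j ∈ (applyPath S P).verts, g ((applyPath S P).pos j) =
      if j ∈ S.verts ∧ Alive j P then some (S.pos j) else none := fun j hj => by
    rw [hg j hj, vTrack_inv_eq j P S hleg hj]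
  have hfin := fun i => mem_final i P S
  have hcost := path_cost_ge hCV hCE S.verts (S.edges ∪ (applyPath S P).edges) P S hS.2.2.1 hleg
  have hGv : ∀ u, u ∈ G.verts ↔ ∃ i ∈ S.verts, S.pos i = u := fun u => by
    rw [← hS.2.1, Finset.mem_image]
  have hHv : ∀ u, u ∈ H.verts ↔ ∃ i ∈ (applyPath S P).verts, (applyPath S P).pos i = u :=
    fun u => by rw [← hT.2.1, Finset.mem_image]
  set T := applyPath S P with hTdef
  let m : Matching d G.toEGraph H.toEGraph :=
    { f := f
      g := g
      f_mem := by
        intro u hu v hv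
        obtain ⟨i, hi, rfl⟩ := (hGv u).1 hu
        rw [hf' i hi] at hv
        split_ifs at hv with hA
        exact (hHv v).2 ⟨i, hfin i hi hA, Option.some.inj hv⟩
      g_mem := by
        intro v hv u hu
        obtain ⟨j, hj, rfl⟩ := (hHv v).1 hv
        rw [hg' j hj] at hu
        split_ifs at hu with hA
        exact (hGv u).2 ⟨j, hA.1, Option.some.inj hu⟩
      consistent := by
        intro u hu v hv
        obtain ⟨i, hi, rfl⟩ := (hGv u).1 hu
        obtain ⟨j, hj, rfl⟩ := (hHv v).1 hv
        rw [hf' i hi, hg' j hj]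
        constructor
        · intro h
          split_ifs at h with hA
          have := hT.1 (hfin i hi hA) hj (Option.some.inj h)
          subst this
          rw [if_pos ⟨hi, hA⟩]
        · intro h
          split_ifs at h with hA
          have := hS.1 hA.1 hi (Option.some.inj h)
          subst this
          rw [if_pos hA.2] }
  refine ⟨m, hf, hg, le_trans ?_ hcost⟩
  have hmf : ∀ e ∈ S.edges, mEdge H.toEGraph f (S.pos e.1, S.pos e.2) =
      if (Alive e.1 P ∧ Alive e.2 P) ∧ e ∈ T.edges then some (T.pos e.1, T.pos e.2) else none := by
    intro e he
    have hv := hS.2.2.1 e he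
    unfold mEdge
    simp only [hf' _ hv.1, hf' _ hv.2]
    by_cases h1 : Alive e.1 P
    · by_cases h2 : Alive e.2 P
      · simp only [h1, h2, if_true, true_and]
        simp only [Represents.mem_edges hT (hfin _ hv.1 h1) (hfin _ hv.2 h2)]
      · simp [h1, h2]
    · simp [h1]
  have hmg : ∀ e ∈ T.edges, mEdge G.toEGraph g (T.pos e.1, T.pos e.2) =
      if (Alive e.1 P ∧ Alive e.2 P) ∧ e ∈ S.edges then some (S.pos e.1, S.pos e.2) else none := by
    intro e he
    have hv := hT.2.2.1 e he
    unfold mEdge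
    simp only [hg' _ hv.1, hg' _ hv.2]
    by_cases h0 : e.1 ∈ S.verts ∧ e.2 ∈ S.verts
    · by_cases h1 : Alive e.1 P
      · by_cases h2 : Alive e.2 P
        · simp only [h1, h2, h0.1, h0.2, if_true, true_and]
          simp only [Represents.mem_edges hS h0.1 h0.2]
        · simp [h1, h2]
      · simp [h1]
    · have : e ∉ S.edges := fun h => h0 (hS.2.2.1 e h)
      simp only [this, and_false, if_false]
      by_cases h1 : e.1 ∈ S.verts
      · have h2 : e.2 ∉ S.verts := fun h => h0 ⟨h1, h⟩
        simp only [h2, false_and, if_false]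
        split <;> simp_all
      · simp [h1]
  have hV : ∑ u ∈ G.verts.filter (fun u => f u ≠ none), CV * odist (some u) (f u) =
      CV * ∑ i ∈ S.verts, vertW S P i := by
    rw [Finset.sum_filter, Represents.sum_verts hS, Finset.mul_sum]
    refine Finset.sum_congr rfl (fun i hi => ?_)
    rw [hf' i hi]
    unfold vertW
    by_cases hA : Alive i P <;> simp [hA, hi, odist, hTdef]
  have hE1 : ∑ e ∈ G.edges.filter (fun e => mEdge H.toEGraph f e ≠ none),
      CE * |dist e.1 e.2 - elen (mEdge H.toEGraph f e)| =
      ∑ e ∈ S.edges ∪ T.edges, if e ∈ S.edges then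
        (if (Alive e.1 P ∧ Alive e.2 P) ∧ e ∈ T.edges then CE * |S.len e - T.len e| else 0)
        else 0 := by
    rw [Finset.sum_filter, Represents.sum_edges hS, Finset.sum_ite_mem,
      Finset.inter_eq_right.2 Finset.subset_union_left]
    refine Finset.sum_congr rfl (fun e he => ?_)
    rw [hmf e he]
    by_cases hA : (Alive e.1 P ∧ Alive e.2 P) ∧ e ∈ T.edges
    · rw [EState.len_mem he, EState.len_mem hA.2]
      simp [hA, elen]
    · simp [hA]
  have hE2 : ∑ e ∈ G.edges.filter (fun e => mEdge H.toEGraph f e = none), CE * dist e.1 e.2 =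
      ∑ e ∈ S.edges ∪ T.edges, if e ∈ S.edges then
        (if (Alive e.1 P ∧ Alive e.2 P) ∧ e ∈ T.edges then 0 else CE * S.len e)
        else 0 := by
    rw [Finset.sum_filter, Represents.sum_edges hS, Finset.sum_ite_mem,
      Finset.inter_eq_right.2 Finset.subset_union_left]
    refine Finset.sum_congr rfl (fun e he => ?_)
    rw [hmf e he]
    by_cases hA : (Alive e.1 P ∧ Alive e.2 P) ∧ e ∈ T.edges
    · simp [hA]
    · rw [EState.len_mem he]
      simp [hA]
  have hE3 : ∑ e ∈ H.edges.filter (fun e => mEdge G.toEGraph g e = none), CE * dist e.1 e.2 =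
      ∑ e ∈ S.edges ∪ T.edges, if e ∈ T.edges then
        (if (Alive e.1 P ∧ Alive e.2 P) ∧ e ∈ S.edges then 0 else CE * T.len e)
        else 0 := by
    rw [Finset.sum_filter, Represents.sum_edges hT, Finset.sum_ite_mem,
      Finset.inter_eq_right.2 Finset.subset_union_right]
    refine Finset.sum_congr rfl (fun e he => ?_)
    rw [hmg e he]
    by_cases hA : (Alive e.1 P ∧ Alive e.2 P) ∧ e ∈ S.edges
    · simp [hA]
    · rw [EState.len_mem he]
      simp [hA]
  unfold matchCost
  change (∑ u ∈ G.verts.filter (fun u => f u ≠ none), CV * odist (some u) (f u)) +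
    (∑ e ∈ G.edges.filter (fun e => mEdge H.toEGraph f e ≠ none),
      CE * |dist e.1 e.2 - elen (mEdge H.toEGraph f e)|) +
    (∑ e ∈ G.edges.filter (fun e => mEdge H.toEGraph f e = none), CE * dist e.1 e.2) +
    (∑ e ∈ H.edges.filter (fun e => mEdge G.toEGraph g e = none), CE * dist e.1 e.2) ≤ _
  rw [hV, hE1, hE2, hE3, add_assoc, add_assoc, ← add_assoc (Finset.sum _ _),
    ← Finset.sum_add_distrib, ← Finset.sum_add_distrib, Finset.mul_sum _ _ CE]
  gcongr with e he
  unfold edgeT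
  rw [← hTdef]
  have hs := S.len_nonneg e
  have ht := T.len_nonneg e
  by_cases h1 : e ∈ S.edges <;> by_cases h2 : e ∈ T.edges <;>
    by_cases hA : Alive e.1 P ∧ Alive e.2 P
  · simp [h1, h2, hA]
  · simp [h1, h2, hA, mul_add]
  · simp [h1, h2, hA, EState.len_not_mem h2, abs_of_nonneg hs]
  · simp [h1, h2, hA, EState.len_not_mem h2]
  · simp [h1, h2, hA, EState.len_not_mem h1, abs_of_nonneg ht]
  · simp [h1, h2, hA, EState.len_not_mem h1]
  · simp [h1, h2, hA, EState.len_not_mem h1, EState.len_not_mem h2]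
  · simp [h1, h2, EState.len_not_mem h1, EState.len_not_mem h2]

/-- For any edit path `P` from `G` to `H`, the induced inexact matching
`π_P = {(u, P(u)) : u ∈ V^G} ∪ {(P⁻¹(v), v) : v ∈ V^H}` satisfies `Cost(π_P) ≤ Cost(P)`.
Consequently, `GGD(G,H) ≤ GED(G,H)` for all geometric graphs `G`, `H` of `ℝ^d`. -/
theorem induced_matching_cost_le_and_ggd_le_ged {d : ℕ} (CV CE : ℝ)
    (hCV : 0 < CV) (hCE : 0 < CE) :
    (∀ (G H : GeoGraph d) (S : EState d) (P : List (EditOp d)),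
      IsEditPathFrom G.toEGraph H.toEGraph S P →
      ∃ m : Matching d G.toEGraph H.toEGraph,
        (∀ i ∈ S.verts, m.f (S.pos i) = vTrack i P (some (S.pos i))) ∧
        (∀ j ∈ (applyPath S P).verts,
          m.g ((applyPath S P).pos j) =
            vTrack j (invPath S P) (some ((applyPath S P).pos j))) ∧
        matchCost CV CE m ≤ pathCost CV CE S P) ∧
    (∀ G H : GeoGraph d, GGD CV CE G H ≤ GED CV CE G H) := by
  refine ⟨fun G H S P hP => induced_matching hCV hCE G H S P hP, fun G H => ?_⟩
  unfold GED GGD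
  apply le_csInf
  · obtain ⟨S, P, h⟩ := exists_editPath G H
    exact ⟨_, S, P, h, rfl⟩
  · rintro c ⟨S, P, h, rfl⟩
    obtain ⟨m, _, _, hm⟩ := induced_matching hCV hCE G H S P h
    refine le_trans (csInf_le ⟨0, ?_⟩ ⟨m, rfl⟩) hm
    rintro c ⟨m', rfl⟩
    exact matchCost_nonneg hCV hCE m'
end
end

section
/- Let G and H be geometric graphs in ℝ^d and let Δ denote the maximum vertex degree over G and H. For any inexact matching π between G and H, there exists an edit path P_π from G to H (which first deletes all edges e∈E^G with π(e)=ε_E, then deletes all vertices u∈V^G with π(u)=ε_V, then translates each remaining vertex u to π(u), then inserts all vertices v∈V^H with π^{-1}(v)=ε_V, then inserts all edges f∈E^H with π^{-1}(f)=ε_E) such that Cost(P_π) ≤ (1 + Δ·C_E/C_V)·Cost(π). Consequently, GED(G,H) ≤ (1 + Δ·C_E/C_V)·GGD(G,H). -/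
open scoped Classical
noncomputable section

theorem sp_applyPath_append {d : ℕ} (S : EState d) (P Q : List (EditOp d)) :
    applyPath S (P ++ Q) = applyPath (applyPath S P) Q := by
  simp [applyPath]

theorem sp_legalPath_append {d : ℕ} (P Q : List (EditOp d)) : ∀ (S : EState d),
    legalPath S (P ++ Q) ↔ legalPath S P ∧ legalPath (applyPath S P) Q := by
  induction P with
  | nil => intro S; simp [legalPath, applyPath]
  | cons o P ih =>
    intro S
    simp only [List.cons_append, legalPath, ih, and_assoc]
    rfl

theorem sp_pathCost_append {d : ℕ} (CV CE : ℝ) (P Q : List (EditOp d)) : ∀ (S : EState d),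
    pathCost CV CE S (P ++ Q) = pathCost CV CE S P + pathCost CV CE (applyPath S P) Q := by
  induction P with
  | nil => intro S; simp [pathCost, applyPath]
  | cons o P ih =>
    intro S
    simp only [List.cons_append, pathCost, ih, add_assoc]
    rfl

theorem sp_pathCost_nonneg {d : ℕ} (CV CE : ℝ) (hCV : 0 < CV) (hCE : 0 < CE)
    (P : List (EditOp d)) : ∀ (S : EState d), 0 ≤ pathCost CV CE S P := by
  induction P with
  | nil => intro S; simp [pathCost]
  | cons o P ih =>
    intro S
    refine add_nonneg ?_ (ih _)
    cases o <;> simp only [EditOp.cost] <;> try positivity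

/-- Phase 1: deleting edges. -/
theorem sp_delEdges {d : ℕ} (CV CE : ℝ) (l : List (ℕ × ℕ)) : ∀ (S : EState d),
    l.Nodup → (∀ e ∈ l, e ∈ S.edges) →
    applyPath S (l.map fun e => EditOp.delEdge e.1 e.2) =
        ⟨S.verts, S.pos, S.edges \ l.toFinset⟩ ∧
      legalPath S (l.map fun e => EditOp.delEdge e.1 e.2) ∧
      pathCost CV CE S (l.map fun e => EditOp.delEdge e.1 e.2) =
        (l.map fun e => CE * dist (S.pos e.1) (S.pos e.2)).sum := by
  induction l with
  | nil => intro S _ _; simp [applyPath, legalPath, pathCost]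
  | cons e l ih =>
    intro S hn hl
    rw [List.nodup_cons] at hn
    have h := ih (EditOp.apply S (EditOp.delEdge e.1 e.2)) hn.2 (by
      intro e' he'
      simp only [EditOp.apply, Finset.mem_erase]
      refine ⟨?_, hl _ (by simp [he'])⟩
      rintro rfl; exact hn.1 he')
    obtain ⟨h1, h2, h3⟩ := h
    refine ⟨?_, ⟨hl _ (by simp), h2⟩, ?_⟩
    · simp only [List.map_cons]
      change applyPath (EditOp.apply S (EditOp.delEdge e.1 e.2)) _ = _
      rw [h1]
      simp only [EditOp.apply, EState.mk.injEq, true_and]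
      ext x; simp; tauto
    · simp only [List.map_cons, pathCost, List.sum_cons, h3]
      simp [EditOp.cost, EditOp.apply]

/-- Phase 2: deleting isolated vertices. -/
theorem sp_delVerts {d : ℕ} (CV CE : ℝ) (l : List ℕ) : ∀ (S : EState d),
    l.Nodup → (∀ i ∈ l, i ∈ S.verts ∧ ∀ e ∈ S.edges, e.1 ≠ i ∧ e.2 ≠ i) →
    applyPath S (l.map fun i => EditOp.delVert i) =
        ⟨S.verts \ l.toFinset, S.pos, S.edges⟩ ∧
      legalPath S (l.map fun i => EditOp.delVert i) ∧
      pathCost CV CE S (l.map fun i => EditOp.delVert i) = 0 := by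
  induction l with
  | nil => intro S _ _; simp [applyPath, legalPath, pathCost]
  | cons e l ih =>
    intro S hn hl
    rw [List.nodup_cons] at hn
    have h := ih (EditOp.apply S (EditOp.delVert e)) hn.2 (by
      intro e' he'
      simp only [EditOp.apply, Finset.mem_erase]
      refine ⟨⟨?_, (hl e' (by simp [he'])).1⟩, (hl e' (by simp [he'])).2⟩
      rintro rfl; exact hn.1 he')
    obtain ⟨h1, h2, h3⟩ := h
    refine ⟨?_, ⟨hl _ (by simp), h2⟩, ?_⟩
    · simp only [List.map_cons]
      change applyPath (EditOp.apply S (EditOp.delVert e)) _ = _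
      rw [h1]
      simp only [EditOp.apply, EState.mk.injEq, and_true]
      ext x; simp; tauto
    · simp only [List.map_cons, pathCost, h3]
      simp [EditOp.cost]

theorem sp_abs_update {d : ℕ} (pos : ℕ → Pt d) (i : ℕ) (p : Pt d) (e : ℕ × ℕ)
    (he : e.1 ≠ e.2) :
    |dist (Function.update pos i p e.1) (Function.update pos i p e.2)
        - dist (pos e.1) (pos e.2)| ≤ if e.1 = i ∨ e.2 = i then dist (pos i) p else 0 := by
  by_cases h1 : e.1 = i
  · have h2 : e.2 ≠ i := by rintro h; exact he (h1.trans h.symm)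
    simp only [h1, true_or, if_true, Function.update_self, Function.update_of_ne h2]
    rw [dist_comm (pos i) p]
    exact abs_dist_sub_le _ _ _
  · by_cases h2 : e.2 = i
    · simp only [h2, or_true, if_true, Function.update_self, Function.update_of_ne h1]
      rw [dist_comm (pos i) p, dist_comm _ p, dist_comm _ (pos i)]
      exact abs_dist_sub_le _ _ _
    · simp [h1, h2]

/-- Phase 3: translating vertices. -/
theorem sp_moveVerts {d : ℕ} (CV CE : ℝ) (hCE : 0 < CE) (D : ℝ) (t : ℕ → Pt d)
    (l : List ℕ) : ∀ (S : EState d),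
    l.Nodup → (∀ i ∈ l, i ∈ S.verts) → (∀ e ∈ S.edges, e.1 ≠ e.2) →
    (∀ i ∈ l, ((S.edges.filter fun e => e.1 = i ∨ e.2 = i).card : ℝ) ≤ D) →
    applyPath S (l.map fun i => EditOp.moveVert i (t i)) =
        ⟨S.verts, fun n => if n ∈ l then t n else S.pos n, S.edges⟩ ∧
      legalPath S (l.map fun i => EditOp.moveVert i (t i)) ∧
      pathCost CV CE S (l.map fun i => EditOp.moveVert i (t i)) ≤
        (l.map fun i => (CV + D * CE) * dist (S.pos i) (t i)).sum := by
  induction l with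
  | nil => intro S _ _ _ _; simp [applyPath, legalPath, pathCost]
  | cons e l ih =>
    intro S hn hl hne hdeg
    rw [List.nodup_cons] at hn
    have h := ih (EditOp.apply S (EditOp.moveVert e (t e))) hn.2
      (fun i hi => hl i (by simp [hi])) hne (fun i hi => hdeg i (by simp [hi]))
    obtain ⟨h1, h2, h3⟩ := h
    refine ⟨?_, ⟨hl _ (by simp), h2⟩, ?_⟩
    · simp only [List.map_cons]
      change applyPath (EditOp.apply S (EditOp.moveVert e (t e))) _ = _
      rw [h1]
      simp only [EditOp.apply, EState.mk.injEq, and_true, true_and]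
      funext n
      by_cases hn' : n = e
      · subst hn'; simp [hn.1]
      · simp [hn']
    · simp only [List.map_cons, pathCost, List.sum_cons]
      refine add_le_add ?_ (h3.trans (le_of_eq ?_))
      · simp only [EditOp.cost]
        have : ∑ x ∈ S.edges,
            CE * |dist (Function.update S.pos e (t e) x.1) (Function.update S.pos e (t e) x.2)
                - dist (S.pos x.1) (S.pos x.2)| ≤ D * CE * dist (S.pos e) (t e) := by
          calc _ ≤ ∑ x ∈ S.edges, CE * (if x.1 = e ∨ x.2 = e then dist (S.pos e) (t e) else 0) := by
                refine Finset.sum_le_sum fun x hx => ?_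
                exact mul_le_mul_of_nonneg_left (sp_abs_update _ _ _ _ (hne x hx)) hCE.le
            _ = ((S.edges.filter fun x => x.1 = e ∨ x.2 = e).card : ℝ)
                  * (CE * dist (S.pos e) (t e)) := by
                rw [← Finset.mul_sum, ← Finset.sum_filter, Finset.sum_const, nsmul_eq_mul]; ring
            _ ≤ D * (CE * dist (S.pos e) (t e)) := by
                refine mul_le_mul_of_nonneg_right (hdeg e (by simp)) (by positivity)
            _ = _ := by ring
        linarith
      · congr 1
        refine List.map_congr_left fun n hn' => ?_
        have : n ≠ e := by rintro rfl; exact hn.1 hn'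
        simp [EditOp.apply, this]

/-- Phase 4: inserting vertices. -/
theorem sp_insVerts {d : ℕ} (CV CE : ℝ) (t : ℕ → Pt d) (l : List ℕ) : ∀ (S : EState d),
    l.Nodup → (∀ i ∈ l, i ∉ S.verts) →
    applyPath S (l.map fun i => EditOp.insVert i (t i)) =
        ⟨S.verts ∪ l.toFinset, fun n => if n ∈ l then t n else S.pos n, S.edges⟩ ∧
      legalPath S (l.map fun i => EditOp.insVert i (t i)) ∧
      pathCost CV CE S (l.map fun i => EditOp.insVert i (t i)) = 0 := by
  induction l with
  | nil => intro S _ _; simp [applyPath, legalPath, pathCost]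
  | cons e l ih =>
    intro S hn hl
    rw [List.nodup_cons] at hn
    have h := ih (EditOp.apply S (EditOp.insVert e (t e))) hn.2 (by
      intro e' he'
      simp only [EditOp.apply, Finset.mem_insert, not_or]
      refine ⟨?_, hl e' (by simp [he'])⟩
      rintro rfl; exact hn.1 he')
    obtain ⟨h1, h2, h3⟩ := h
    refine ⟨?_, ⟨hl _ (by simp), h2⟩, ?_⟩
    · simp only [List.map_cons]
      change applyPath (EditOp.apply S (EditOp.insVert e (t e))) _ = _
      rw [h1]
      simp only [EditOp.apply, EState.mk.injEq, and_true]
      constructor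
      · ext x; simp
      · funext n
        by_cases hn' : n = e
        · subst hn'; simp [hn.1]
        · simp [hn']
    · simp only [List.map_cons, pathCost, h3]
      simp [EditOp.cost]

/-- Phase 5: inserting edges. -/
theorem sp_insEdges {d : ℕ} (CV CE : ℝ) (l : List (ℕ × ℕ)) : ∀ (S : EState d),
    l.Nodup → (∀ e ∈ l, e.1 ∈ S.verts ∧ e.2 ∈ S.verts ∧ e ∉ S.edges) →
    applyPath S (l.map fun e => EditOp.insEdge e.1 e.2) =
        ⟨S.verts, S.pos, S.edges ∪ l.toFinset⟩ ∧
      legalPath S (l.map fun e => EditOp.insEdge e.1 e.2) ∧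
      pathCost CV CE S (l.map fun e => EditOp.insEdge e.1 e.2) =
        (l.map fun e => CE * dist (S.pos e.1) (S.pos e.2)).sum := by
  induction l with
  | nil => intro S _ _; simp [applyPath, legalPath, pathCost]
  | cons e l ih =>
    intro S hn hl
    rw [List.nodup_cons] at hn
    have h := ih (EditOp.apply S (EditOp.insEdge e.1 e.2)) hn.2 (by
      intro e' he'
      have h0 := hl e' (by simp [he'])
      simp only [EditOp.apply, Finset.mem_insert, not_or]
      refine ⟨h0.1, h0.2.1, ?_, h0.2.2⟩
      rintro rfl; exact hn.1 he')
    obtain ⟨h1, h2, h3⟩ := h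
    refine ⟨?_, ⟨hl _ (by simp), h2⟩, ?_⟩
    · simp only [List.map_cons]
      change applyPath (EditOp.apply S (EditOp.insEdge e.1 e.2)) _ = _
      rw [h1]
      simp only [EditOp.apply, EState.mk.injEq, true_and]
      ext x; simp
    · simp only [List.map_cons, pathCost, List.sum_cons, h3]
      simp [EditOp.cost, EditOp.apply]

theorem sp_represents {d : ℕ} (S : EState d) (G : GeoGraph d) (c : Pt d → ℕ)
    (hv : S.verts = G.verts.image c)
    (he : S.edges = G.edges.image fun e => (c e.1, c e.2))
    (hp : ∀ v ∈ G.verts, S.pos (c v) = v) : S.Represents G.toEGraph := by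
  refine ⟨?_, ?_, ?_, ?_⟩
  · intro x hx y hy hxy
    simp only [hv, Finset.coe_image, Set.mem_image, Finset.mem_coe] at hx hy
    obtain ⟨u, hu, rfl⟩ := hx
    obtain ⟨v, hv', rfl⟩ := hy
    rw [hp u hu, hp v hv'] at hxy
    rw [hxy]
  · rw [hv, Finset.image_image]
    conv_rhs => rw [← Finset.image_id (s := G.verts)]
    exact Finset.image_congr fun v hv' => hp v hv'
  · intro e h
    rw [he, Finset.mem_image] at h
    obtain ⟨f, hf, rfl⟩ := h
    rw [hv]
    exact ⟨Finset.mem_image_of_mem _ (G.edge_fst_mem f hf),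
      Finset.mem_image_of_mem _ (G.edge_snd_mem f hf)⟩
  · rw [he, Finset.image_image]
    conv_rhs => rw [← Finset.image_id (s := G.edges)]
    refine Finset.image_congr fun f hf => ?_
    simp [hp _ (G.edge_fst_mem f hf), hp _ (G.edge_snd_mem f hf)]

theorem sp_mEdge_ne_none {d : ℕ} (T : EGraph d) (φ : Pt d → Option (Pt d)) (e : Pt d × Pt d) :
    ¬ mEdge T φ e = none ↔ ∃ a b, φ e.1 = some a ∧ φ e.2 = some b ∧ (a, b) ∈ T.edges := by
  unfold mEdge
  rcases h1 : φ e.1 with _ | a <;> rcases h2 : φ e.2 with _ | b <;> simp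

theorem sp_labels {d : ℕ} (A B : Finset (Pt d)) : ∃ (a b : Pt d → ℕ),
    Set.InjOn a A ∧ Set.InjOn b B ∧ ∀ u ∈ A, ∀ v ∈ B, a u ≠ b v := by
  refine ⟨fun u => A.toList.idxOf u, fun v => A.card + B.toList.idxOf v, ?_, ?_, ?_⟩
  · intro x hx y hy h
    exact (List.idxOf_inj (by simpa using hx)).1 h
  · intro x hx y hy h
    exact (List.idxOf_inj (by simpa using hx)).1 (Nat.add_left_cancel h)
  · intro u hu v hv h
    have : A.toList.idxOf u < A.toList.length := List.idxOf_lt_length_of_mem (by simpa using hu)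
    rw [Finset.length_toList] at this
    simp only at h
    omega

theorem sp_structured {d : ℕ} (CV CE : ℝ) (hCV : 0 < CV) (hCE : 0 < CE)
    (G H : GeoGraph d) (m : Matching d G.toEGraph H.toEGraph) :
      ∃ (S : EState d) (DE DV TV IV IE : List (EditOp d)),
        S.Represents G.toEGraph ∧
        (∀ o ∈ DE, ∃ e ∈ S.edges,
            mEdge H.toEGraph m.f (S.pos e.1, S.pos e.2) = none ∧
            o = EditOp.delEdge e.1 e.2) ∧
        (∀ e ∈ S.edges, mEdge H.toEGraph m.f (S.pos e.1, S.pos e.2) = none →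
            EditOp.delEdge e.1 e.2 ∈ DE) ∧
        (∀ o ∈ DV, ∃ i ∈ S.verts, m.f (S.pos i) = none ∧ o = EditOp.delVert i) ∧
        (∀ i ∈ S.verts, m.f (S.pos i) = none → EditOp.delVert i ∈ DV) ∧
        (∀ o ∈ TV, ∃ i ∈ S.verts, ∃ v, m.f (S.pos i) = some v ∧ o = EditOp.moveVert i v) ∧
        (∀ i ∈ S.verts, ∀ v, m.f (S.pos i) = some v → EditOp.moveVert i v ∈ TV) ∧
        (∀ o ∈ IV, ∃ v ∈ H.verts, m.g v = none ∧ ∃ i, o = EditOp.insVert i v) ∧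
        (∀ v ∈ H.verts, m.g v = none → ∃ i, EditOp.insVert i v ∈ IV) ∧
        (∀ o ∈ IE, ∃ f ∈ H.edges, mEdge G.toEGraph m.g f = none ∧
            ∃ i j, o = EditOp.insEdge i j ∧
              (applyPath S (DE ++ DV ++ TV ++ IV)).pos i = f.1 ∧
              (applyPath S (DE ++ DV ++ TV ++ IV)).pos j = f.2) ∧
        IsEditPathFrom G.toEGraph H.toEGraph S (DE ++ DV ++ TV ++ IV ++ IE) ∧
        pathCost CV CE S (DE ++ DV ++ TV ++ IV ++ IE) ≤
          (1 + (max G.toEGraph.maxDegree H.toEGraph.maxDegree : ℝ) * CE / CV) *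
            matchCost CV CE m := by
  set B : Finset (Pt d) := H.verts.filter (fun v => m.g v = none) with hB
  obtain ⟨a, b, ha, hb, hab⟩ := sp_labels G.verts B
  obtain ⟨pos, hpos⟩ : ∃ pos : ℕ → Pt d, ∀ u ∈ G.verts, pos (a u) = u :=
    ⟨Function.invFunOn a G.verts, fun u hu => ha.leftInvOn_invFunOn hu⟩
  obtain ⟨t, htA, htB⟩ : ∃ t : ℕ → Pt d,
      (∀ u ∈ G.verts, ∀ v, m.f u = some v → t (a u) = v) ∧ (∀ v ∈ B, t (b v) = v) := by
    refine ⟨fun n => if n ∈ B.image b then Function.invFunOn b B n else (m.f (pos n)).getD 0,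
      ?_, ?_⟩
    · intro u hu v hv
      have : a u ∉ B.image b := by
        rw [Finset.mem_image]
        rintro ⟨w, hw, h⟩
        exact hab u hu w hw h.symm
      simp only [this, if_false, hpos u hu, hv, Option.getD_some]
    · intro v hv
      have : b v ∈ B.image b := Finset.mem_image_of_mem _ hv
      simp only [this, if_true]
      exact hb.leftInvOn_invFunOn hv
  -- labels of the vertices of `H`
  obtain ⟨c, hcS, hcN⟩ : ∃ c : Pt d → ℕ,
      (∀ v u, m.g v = some u → c v = a u) ∧ (∀ v, m.g v = none → c v = b v) := by
    refine ⟨fun v => (m.g v).elim (b v) a, ?_, ?_⟩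
    · intro v u h; simp [h]
    · intro v h; simp [h]
  have hcf : ∀ u ∈ G.verts, ∀ v, m.f u = some v → v ∈ H.verts ∧ c v = a u := by
    intro u hu v huv
    have hv := m.f_mem u hu v huv
    exact ⟨hv, hcS v u ((m.consistent u hu v hv).1 huv)⟩
  have htc : ∀ v ∈ H.verts, t (c v) = v := by
    intro v hv
    rcases h : m.g v with _ | u
    · rw [hcN v h]; exact htB v (by simp [hB, hv, h])
    · have hu := m.g_mem v hv u h
      rw [hcS v u h]; exact htA u hu v ((m.consistent u hu v hv).2 h)
  have hcinj : Set.InjOn c H.verts := by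
    intro x hx y hy h
    rw [← htc x hx, ← htc y hy, h]
  set S : EState d := ⟨G.verts.image a, pos, G.edges.image fun e => (a e.1, a e.2)⟩ with hS
  have hSG : S.Represents G.toEGraph := sp_represents S G a rfl rfl hpos
  have hE1 := G.edge_fst_mem
  have hE2 := G.edge_snd_mem
  have hF1 := H.edge_fst_mem
  have hF2 := H.edge_snd_mem
  have haa : Set.InjOn (fun e : Pt d × Pt d => (a e.1, a e.2)) G.edges := by
    intro x hx y hy h
    simp only [Prod.mk.injEq] at h
    exact Prod.ext (ha (hE1 x hx) (hE1 y hy) h.1) (ha (hE2 x hx) (hE2 y hy) h.2)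
  have hcc : Set.InjOn (fun e : Pt d × Pt d => (c e.1, c e.2)) H.edges := by
    intro x hx y hy h
    simp only [Prod.mk.injEq] at h
    exact Prod.ext (hcinj (hF1 x hx) (hF1 y hy) h.1) (hcinj (hF2 x hx) (hF2 y hy) h.2)
  set lDE : Finset (ℕ × ℕ) :=
    S.edges.filter (fun e => mEdge H.toEGraph m.f (S.pos e.1, S.pos e.2) = none) with hlDE
  set lDV : Finset ℕ := S.verts.filter (fun i => m.f (S.pos i) = none) with hlDV
  set lTV : Finset ℕ := S.verts.filter (fun i => m.f (S.pos i) ≠ none) with hlTV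
  set lIV : Finset ℕ := B.image b with hlIV
  set lIE : Finset (ℕ × ℕ) :=
    (H.edges.filter (fun f => mEdge G.toEGraph m.g f = none)).image
      (fun e => (c e.1, c e.2)) with hlIE
  -- phase 1
  obtain ⟨p1, q1, r1⟩ := sp_delEdges CV CE lDE.toList S lDE.nodup_toList (by
    intro e he
    rw [Finset.mem_toList, hlDE, Finset.mem_filter] at he
    exact he.1)
  rw [Finset.toList_toFinset] at p1
  have hkept : ∀ e, e ∈ S.edges \ lDE ↔ ∃ f ∈ G.edges,
      ¬ mEdge H.toEGraph m.f f = none ∧ e = (a f.1, a f.2) := by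
    intro e
    simp only [hlDE, Finset.mem_sdiff, Finset.mem_filter, hS, Finset.mem_image]
    constructor
    · rintro ⟨⟨f, hf, rfl⟩, h⟩
      refine ⟨f, hf, fun h0 => h ⟨⟨f, hf, rfl⟩, ?_⟩, rfl⟩
      simpa [hpos _ (hE1 f hf), hpos _ (hE2 f hf)] using h0
    · rintro ⟨f, hf, h, rfl⟩
      refine ⟨⟨f, hf, rfl⟩, fun h0 => h ?_⟩
      simpa [hpos _ (hE1 f hf), hpos _ (hE2 f hf)] using h0.2
  set S1 : EState d := ⟨S.verts, S.pos, S.edges \ lDE⟩ with hS1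
  -- phase 2
  obtain ⟨p2, q2, r2⟩ := sp_delVerts CV CE lDV.toList S1 lDV.nodup_toList (by
    intro i hi
    rw [Finset.mem_toList, hlDV, Finset.mem_filter] at hi
    refine ⟨hi.1, ?_⟩
    intro e he
    obtain ⟨f, hf, hne, rfl⟩ := (hkept e).1 he
    obtain ⟨x, y, hx, hy, -⟩ := (sp_mEdge_ne_none _ _ _).1 hne
    constructor
    · rintro rfl
      have := hi.2
      simp [hS, hpos _ (hE1 f hf), hx] at this
    · rintro rfl
      have := hi.2
      simp [hS, hpos _ (hE2 f hf), hy] at this)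
  rw [Finset.toList_toFinset] at p2
  set S2 : EState d := ⟨S1.verts \ lDV, S1.pos, S1.edges⟩ with hS2
  -- phase 3
  obtain ⟨p3, q3, r3⟩ := sp_moveVerts CV CE hCE
    (max G.toEGraph.maxDegree H.toEGraph.maxDegree : ℝ) t lTV.toList S2 lTV.nodup_toList (by
    intro i hi
    rw [Finset.mem_toList, hlTV, Finset.mem_filter] at hi
    simp only [hS2, hS1, hlDV, Finset.mem_sdiff, Finset.mem_filter]
    tauto) (by
    intro e he
    obtain ⟨f, hf, hne, rfl⟩ := (hkept e).1 he
    intro h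
    exact G.edge_ne f hf (ha (hE1 f hf) (hE2 f hf) h)) (by
    intro i hi
    rw [Finset.mem_toList, hlTV, Finset.mem_filter] at hi
    obtain ⟨u, hu, rfl⟩ := Finset.mem_image.1 hi.1
    refine le_trans ?_ (le_max_left _ _)
    rw [Nat.cast_le]
    refine le_trans ?_ (Finset.le_sup (f := G.toEGraph.degree) hu)
    unfold EGraph.degree
    refine le_trans (Finset.card_le_card ?_)
      (Finset.card_image_le (f := fun e : Pt d × Pt d => (a e.1, a e.2)))
    intro e he
    rw [Finset.mem_filter] at he
    obtain ⟨f, hf, hne, rfl⟩ := (hkept e).1 he.1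
    refine Finset.mem_image.2 ⟨f, Finset.mem_filter.2 ⟨hf, ?_⟩, rfl⟩
    exact he.2.imp (fun h => ha (hE1 f hf) hu h) (fun h => ha (hE2 f hf) hu h))
  set S3 : EState d := ⟨S2.verts, fun n => if n ∈ lTV.toList then t n else S2.pos n, S2.edges⟩
    with hS3
  -- phase 4
  obtain ⟨p4, q4, r4⟩ := sp_insVerts CV CE t lIV.toList S3 lIV.nodup_toList (by
    intro i hi
    rw [Finset.mem_toList, hlIV, Finset.mem_image] at hi
    obtain ⟨v, hv, rfl⟩ := hi
    simp only [hS3, hS2, hS1, hS, Finset.mem_sdiff, Finset.mem_image]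
    rintro ⟨⟨u, hu, h⟩, -⟩
    exact hab u hu v hv h)
  rw [Finset.toList_toFinset] at p4
  set S4 : EState d := ⟨S3.verts ∪ lIV, fun n => if n ∈ lIV.toList then t n else S3.pos n,
    S3.edges⟩ with hS4
  have hmemTV : ∀ u ∈ G.verts, ∀ v, m.f u = some v → a u ∈ lTV := by
    intro u hu v huv
    rw [hlTV, Finset.mem_filter]
    refine ⟨Finset.mem_image_of_mem _ hu, ?_⟩
    simp [hS, hpos u hu, huv]
  have hv4 : S4.verts = H.verts.image c := by
    ext n
    simp only [hS4, hS3, hS2, hS1, Finset.mem_union, Finset.mem_sdiff, hlDV, Finset.mem_filter,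
      hlIV, Finset.mem_image]
    constructor
    · rintro (⟨h1, h2⟩ | ⟨v, hv, rfl⟩)
      · obtain ⟨u, hu, rfl⟩ := Finset.mem_image.1 h1
        rcases hfu : m.f u with _ | v
        · exact absurd ⟨h1, by simp [hS, hpos u hu, hfu]⟩ h2
        · obtain ⟨hv, hcv⟩ := hcf u hu v hfu
          exact ⟨v, hv, hcv⟩
      · rw [hB, Finset.mem_filter] at hv
        exact ⟨v, hv.1, hcN v hv.2⟩
    · rintro ⟨v, hv, rfl⟩
      rcases h : m.g v with _ | u
      · right
        exact ⟨v, by simp [hB, hv, h], (hcN v h).symm⟩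
      · left
        have hu := m.g_mem v hv u h
        have hfu := (m.consistent u hu v hv).2 h
        rw [hcS v u h]
        refine ⟨Finset.mem_image_of_mem _ hu, ?_⟩
        rintro ⟨-, h0⟩
        simp [hS, hpos u hu, hfu] at h0
  have hp4 : ∀ v ∈ H.verts, S4.pos (c v) = v := by
    intro v hv
    have : S4.pos (c v) = t (c v) := by
      simp only [hS4, hS3, Finset.mem_toList]
      rcases h : m.g v with _ | u
      · have : c v ∈ lIV := by
          rw [hcN v h]
          exact Finset.mem_image_of_mem _ (by simp [hB, hv, h])
        simp [this]
      · have hu := m.g_mem v hv u h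
        have hfu := (m.consistent u hu v hv).2 h
        have : c v ∈ lTV := by
          rw [hcS v u h]; exact hmemTV u hu v hfu
        simp [this]
    rw [this, htc v hv]
  have he4 : ∀ e, e ∈ S4.edges ↔ ∃ f ∈ H.edges,
      ¬ mEdge G.toEGraph m.g f = none ∧ e = (c f.1, c f.2) := by
    intro e
    change e ∈ S.edges \ lDE ↔ _
    rw [hkept]
    constructor
    · rintro ⟨f, hf, hne, rfl⟩
      obtain ⟨x, y, hx, hy, hxy⟩ := (sp_mEdge_ne_none _ _ _).1 hne
      obtain ⟨hxv, hcx⟩ := hcf _ (hE1 f hf) x hx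
      obtain ⟨hyv, hcy⟩ := hcf _ (hE2 f hf) y hy
      refine ⟨(x, y), hxy, (sp_mEdge_ne_none _ _ _).2 ⟨f.1, f.2, ?_, ?_, hf⟩, ?_⟩
      · exact (m.consistent _ (hE1 f hf) x hxv).1 hx
      · exact (m.consistent _ (hE2 f hf) y hyv).1 hy
      · rw [hcx, hcy]
    · rintro ⟨f, hf, hne, rfl⟩
      obtain ⟨x, y, hx, hy, hxy⟩ := (sp_mEdge_ne_none _ _ _).1 hne
      refine ⟨(x, y), hxy, (sp_mEdge_ne_none _ _ _).2 ⟨f.1, f.2, ?_, ?_, hf⟩, ?_⟩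
      · exact (m.consistent x (hE1 _ hxy) _ (hF1 f hf)).2 hx
      · exact (m.consistent y (hE2 _ hxy) _ (hF2 f hf)).2 hy
      · rw [hcS _ _ hx, hcS _ _ hy]
  -- phase 5
  obtain ⟨p5, q5, r5⟩ := sp_insEdges CV CE lIE.toList S4 lIE.nodup_toList (by
    intro e he
    rw [Finset.mem_toList, hlIE, Finset.mem_image] at he
    obtain ⟨f, hf, rfl⟩ := he
    rw [Finset.mem_filter] at hf
    refine ⟨?_, ?_, ?_⟩
    · rw [hv4]; exact Finset.mem_image_of_mem _ (hF1 f hf.1)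
    · rw [hv4]; exact Finset.mem_image_of_mem _ (hF2 f hf.1)
    · rw [he4]
      rintro ⟨f', hf', hne, h⟩
      have := hcc hf.1 hf' h
      subst this
      exact hne hf.2)
  rw [Finset.toList_toFinset] at p5
  have hSH : (⟨S4.verts, S4.pos, S4.edges ∪ lIE⟩ : EState d).Represents H.toEGraph := by
    refine sp_represents _ H c hv4 ?_ hp4
    ext e
    simp only [Finset.mem_union, he4, hlIE, Finset.mem_image, Finset.mem_filter]
    constructor
    · rintro (⟨f, hf, -, rfl⟩ | ⟨f, hf, rfl⟩)
      · exact ⟨f, hf, rfl⟩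
      · exact ⟨f, hf.1, rfl⟩
    · rintro ⟨f, hf, rfl⟩
      by_cases h : mEdge G.toEGraph m.g f = none
      · exact Or.inr ⟨f, ⟨hf, h⟩, rfl⟩
      · exact Or.inl ⟨f, hf, h, rfl⟩
  have hlast : applyPath S ((lDE.toList.map fun e => EditOp.delEdge e.1 e.2) ++
      (lDV.toList.map fun i => EditOp.delVert i) ++
      (lTV.toList.map fun i => EditOp.moveVert i (t i)) ++
      (lIV.toList.map fun i => EditOp.insVert i (t i))) = S4 := by
    rw [sp_applyPath_append, sp_applyPath_append, sp_applyPath_append, p1, p2, p3, p4]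
  refine ⟨S, lDE.toList.map fun e => EditOp.delEdge e.1 e.2,
    lDV.toList.map fun i => EditOp.delVert i,
    lTV.toList.map fun i => EditOp.moveVert i (t i),
    lIV.toList.map fun i => EditOp.insVert i (t i),
    lIE.toList.map fun e => EditOp.insEdge e.1 e.2, hSG, ?_, ?_, ?_, ?_, ?_, ?_, ?_, ?_, ?_,
    ⟨hSG, ?_, ?_⟩, ?_⟩
  · intro o ho
    obtain ⟨e, he, rfl⟩ := List.mem_map.1 ho
    rw [Finset.mem_toList, hlDE, Finset.mem_filter] at he
    exact ⟨e, he.1, he.2, rfl⟩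
  · intro e he h
    refine List.mem_map.2 ⟨e, ?_, rfl⟩
    rw [Finset.mem_toList, hlDE, Finset.mem_filter]
    exact ⟨he, h⟩
  · intro o ho
    obtain ⟨e, he, rfl⟩ := List.mem_map.1 ho
    rw [Finset.mem_toList, hlDV, Finset.mem_filter] at he
    exact ⟨e, he.1, he.2, rfl⟩
  · intro e he h
    refine List.mem_map.2 ⟨e, ?_, rfl⟩
    rw [Finset.mem_toList, hlDV, Finset.mem_filter]
    exact ⟨he, h⟩
  · intro o ho
    obtain ⟨i, hi, rfl⟩ := List.mem_map.1 ho
    rw [Finset.mem_toList, hlTV, Finset.mem_filter] at hi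
    obtain ⟨v, hv⟩ := Option.ne_none_iff_exists'.1 hi.2
    obtain ⟨u, hu, rfl⟩ := Finset.mem_image.1 hi.1
    refine ⟨a u, hi.1, v, hv, ?_⟩
    rw [htA u hu v (by simpa [hS, hpos u hu] using hv)]
  · intro i hi v hv
    obtain ⟨u, hu, rfl⟩ := Finset.mem_image.1 hi
    have hfu : m.f u = some v := by simpa [hS, hpos u hu] using hv
    refine List.mem_map.2 ⟨a u, ?_, ?_⟩
    · rw [Finset.mem_toList]; exact hmemTV u hu v hfu
    · rw [htA u hu v hfu]
  · intro o ho
    obtain ⟨i, hi, rfl⟩ := List.mem_map.1 ho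
    rw [Finset.mem_toList, hlIV, Finset.mem_image] at hi
    obtain ⟨v, hv, rfl⟩ := hi
    rw [htB v hv]
    rw [hB, Finset.mem_filter] at hv
    exact ⟨v, hv.1, hv.2, b v, rfl⟩
  · intro v hv h
    have hvB : v ∈ B := by simp [hB, hv, h]
    refine ⟨b v, List.mem_map.2 ⟨b v, ?_, by rw [htB v hvB]⟩⟩
    rw [Finset.mem_toList]
    exact Finset.mem_image_of_mem _ hvB
  · intro o ho
    obtain ⟨e, he, rfl⟩ := List.mem_map.1 ho
    rw [Finset.mem_toList, hlIE, Finset.mem_image] at he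
    obtain ⟨f, hf, rfl⟩ := he
    rw [Finset.mem_filter] at hf
    refine ⟨f, hf.1, hf.2, c f.1, c f.2, rfl, ?_, ?_⟩
    · rw [hlast]; exact hp4 _ (hF1 f hf.1)
    · rw [hlast]; exact hp4 _ (hF2 f hf.1)
  · rw [sp_legalPath_append, hlast, sp_legalPath_append, sp_legalPath_append,
      sp_legalPath_append]
    simp only [sp_applyPath_append, p1, p2, p3]
    exact ⟨⟨⟨⟨q1, q2⟩, q3⟩, q4⟩, q5⟩
  · rw [sp_applyPath_append, hlast, p5]
    exact hSH
  · rw [sp_pathCost_append, hlast, sp_pathCost_append, sp_pathCost_append,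
      sp_pathCost_append]
    simp only [sp_applyPath_append, p1, p2, p3]
    rw [r1, r2, r4, r5]
    rw [Finset.sum_map_toList, Finset.sum_map_toList]
    rw [Finset.sum_map_toList] at r3
    set D : ℝ := max (G.toEGraph.maxDegree : ℝ) (H.toEGraph.maxDegree : ℝ) with hD
    have hD0 : 0 ≤ D := le_trans (Nat.cast_nonneg _) (le_max_left _ _)
    have e1 : ∑ e ∈ lDE, CE * dist (S.pos e.1) (S.pos e.2) =
        ∑ e ∈ G.edges.filter (fun e => mEdge H.toEGraph m.f e = none), CE * dist e.1 e.2 := by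
      rw [hlDE, Finset.sum_filter, Finset.sum_filter, hS, Finset.sum_image haa]
      refine Finset.sum_congr rfl fun e he => ?_
      simp [hpos _ (hE1 e he), hpos _ (hE2 e he)]
    have e3 : ∑ i ∈ lTV, (CV + D * CE) * dist (S2.pos i) (t i) =
        (1 + D * CE / CV) *
          ∑ u ∈ G.verts.filter (fun u => m.f u ≠ none), CV * odist (some u) (m.f u) := by
      rw [Finset.mul_sum, hlTV, Finset.sum_filter, Finset.sum_filter, hS]
      rw [Finset.sum_image ha]
      refine Finset.sum_congr rfl fun u hu => ?_
      rcases hfu : m.f u with _ | v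
      · simp [hpos u hu, hfu]
      · simp only [hS2, hS1, hS, hpos u hu, hfu, htA u hu v hfu, odist]
        simp only [ne_eq, reduceCtorEq, not_false_eq_true, if_true]
        field_simp
    have e5 : ∑ e ∈ lIE, CE * dist (S4.pos e.1) (S4.pos e.2) =
        ∑ f ∈ H.edges.filter (fun f => mEdge G.toEGraph m.g f = none), CE * dist f.1 f.2 := by
      rw [hlIE, Finset.sum_image (fun x hx y hy h =>
        hcc (Finset.mem_filter.1 hx).1 (Finset.mem_filter.1 hy).1 h)]
      refine Finset.sum_congr rfl fun e he => ?_
      have he' := (Finset.mem_filter.1 he).1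
      simp only [hp4 _ (hF1 e he'), hp4 _ (hF2 e he')]
    rw [e3] at r3
    rw [e1, e5]
    unfold matchCost
    have n2 : 0 ≤ ∑ e ∈ G.edges.filter (fun e => mEdge H.toEGraph m.f e ≠ none),
      CE * |dist e.1 e.2 - elen (mEdge H.toEGraph m.f e)| :=
      Finset.sum_nonneg fun e _ => by positivity
    have n3 : 0 ≤ ∑ e ∈ G.edges.filter (fun e => mEdge H.toEGraph m.f e = none),
      CE * dist e.1 e.2 := Finset.sum_nonneg fun e _ => by positivity
    have n4 : 0 ≤ ∑ f ∈ H.edges.filter (fun f => mEdge G.toEGraph m.g f = none),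
      CE * dist f.1 f.2 := Finset.sum_nonneg fun e _ => by positivity
    have hK : 0 ≤ D * CE / CV := by positivity
    have k2 := mul_nonneg hK n2
    have k3 := mul_nonneg hK n3
    have k4 := mul_nonneg hK n4
    linarith

/-- For any inexact matching `π` between `G` and `H` there is an edit path `P_π`
from `G` to `H` of the form `D_E ++ D_V ++ T_V ++ I_V ++ I_E` — first deleting every edge
`e ∈ E^G` with `π(e) = ε_E`, then deleting every vertex `u ∈ V^G` with `π(u) = ε_V`, then
translating every remaining vertex `u` to `π(u)`, then inserting every vertex `v ∈ V^H` with
`π⁻¹(v) = ε_V`, then inserting every edge `f ∈ E^H` with `π⁻¹(f) = ε_E` — such that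
`Cost(P_π) ≤ (1 + Δ·C_E/C_V)·Cost(π)`, where `Δ` is the maximum degree of `G`, `H`.
Consequently, `GED(G,H) ≤ (1 + Δ·C_E/C_V)·GGD(G,H)`. -/
theorem structured_path_from_matching {d : ℕ} (CV CE : ℝ) (hCV : 0 < CV) (hCE : 0 < CE) :
    (∀ (G H : GeoGraph d) (m : Matching d G.toEGraph H.toEGraph),
      ∃ (S : EState d) (DE DV TV IV IE : List (EditOp d)),
        S.Represents G.toEGraph ∧
        (∀ o ∈ DE, ∃ e ∈ S.edges,
            mEdge H.toEGraph m.f (S.pos e.1, S.pos e.2) = none ∧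
            o = EditOp.delEdge e.1 e.2) ∧
        (∀ e ∈ S.edges, mEdge H.toEGraph m.f (S.pos e.1, S.pos e.2) = none →
            EditOp.delEdge e.1 e.2 ∈ DE) ∧
        (∀ o ∈ DV, ∃ i ∈ S.verts, m.f (S.pos i) = none ∧ o = EditOp.delVert i) ∧
        (∀ i ∈ S.verts, m.f (S.pos i) = none → EditOp.delVert i ∈ DV) ∧
        (∀ o ∈ TV, ∃ i ∈ S.verts, ∃ v, m.f (S.pos i) = some v ∧ o = EditOp.moveVert i v) ∧
        (∀ i ∈ S.verts, ∀ v, m.f (S.pos i) = some v → EditOp.moveVert i v ∈ TV) ∧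
        (∀ o ∈ IV, ∃ v ∈ H.verts, m.g v = none ∧ ∃ i, o = EditOp.insVert i v) ∧
        (∀ v ∈ H.verts, m.g v = none → ∃ i, EditOp.insVert i v ∈ IV) ∧
        (∀ o ∈ IE, ∃ f ∈ H.edges, mEdge G.toEGraph m.g f = none ∧
            ∃ i j, o = EditOp.insEdge i j ∧
              (applyPath S (DE ++ DV ++ TV ++ IV)).pos i = f.1 ∧
              (applyPath S (DE ++ DV ++ TV ++ IV)).pos j = f.2) ∧
        IsEditPathFrom G.toEGraph H.toEGraph S (DE ++ DV ++ TV ++ IV ++ IE) ∧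
        pathCost CV CE S (DE ++ DV ++ TV ++ IV ++ IE) ≤
          (1 + (max G.toEGraph.maxDegree H.toEGraph.maxDegree : ℝ) * CE / CV) *
            matchCost CV CE m) ∧
    (∀ G H : GeoGraph d,
      GED CV CE G H ≤
        (1 + (max G.toEGraph.maxDegree H.toEGraph.maxDegree : ℝ) * CE / CV) *
          GGD CV CE G H) := by
  refine ⟨fun G H m => sp_structured CV CE hCV hCE G H m, fun G H => ?_⟩
  set D : ℝ := max (G.toEGraph.maxDegree : ℝ) (H.toEGraph.maxDegree : ℝ) with hD
  have hD0 : 0 ≤ D := le_trans (Nat.cast_nonneg _) (le_max_left _ _)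
  have hK : 0 < 1 + D * CE / CV := by positivity
  rw [mul_comm, ← div_le_iff₀ hK]
  unfold GGD
  refine le_csInf ?_ ?_
  · exact ⟨_, ⟨fun _ => none, fun _ => none, by simp, by simp, by simp⟩, rfl⟩
  · rintro c ⟨m, rfl⟩
    rw [div_le_iff₀ hK, mul_comm]
    obtain ⟨S, DE, DV, TV, IV, IE, -, -, -, -, -, -, -, -, -, -, hp, hc⟩ :=
      sp_structured CV CE hCV hCE G H m
    refine le_trans (csInf_le ?_ ⟨S, _, hp, rfl⟩) hc
    refine ⟨0, ?_⟩
    rintro x ⟨S', P, -, rfl⟩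
    exact sp_pathCost_nonneg CV CE hCV hCE P S'
end
end
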